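/- The function f is continuous at every P₃-irrational point of [0,1]: if x₀ ∈ [0,1] has a unique P₃-representation (no representation eventually constant 0 or eventually constant 2), then lim_{x→x₀} f(x) = f(x₀). -/

import Mathlib

open Filter MeasureTheory Finset

/-- The "beta" values `β₀ = 0`, `β₁ = p₀`, `β₂ = p₀ + p₁` associated with weights `p`. -/
noncomputable def P3beta (p : Fin 3 → ℝ) : Fin 3 → ℝ := ![0, p 0, p 0 + p 1]

/-- The P₃-value of a digit sequence `i : ℕ → Fin 3` (0-indexed):
`val(i) = β_{i₀} + Σ_{k≥1} β_{i_k} ∏_{r<k} p_{i_r}`. -/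
noncomputable def P3val (p : Fin 3 → ℝ) (i : ℕ → Fin 3) : ℝ :=
  ∑' k : ℕ, P3beta p (i k) * ∏ r ∈ Finset.range k, p (i r)

/-- The digit permutation θ with θ(0)=0, θ(1)=2, θ(2)=1. -/
def P3theta : Fin 3 → Fin 3 := ![0, 2, 1]

/-- The one-sided shift on digit sequences. -/
def P3shift (i : ℕ → Fin 3) : ℕ → Fin 3 := fun k => i (k + 1)

lemma exists_bound_P3 {p : Fin 3 → ℝ} (hp : ∀ t, p t ∈ Set.Ioo (0 : ℝ) 1) :
    ∃ q : ℝ, 0 ≤ q ∧ q < 1 ∧ ∀ t, p t ≤ q := by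
  obtain ⟨m, hm⟩ := Finite.exists_max p
  exact ⟨p m, (hp m).1.le, (hp m).2, hm⟩

lemma P3beta_nonneg {p : Fin 3 → ℝ} (hp : ∀ t, p t ∈ Set.Ioo (0 : ℝ) 1) (t : Fin 3) :
    0 ≤ P3beta p t := by
  have h0 := (hp 0).1
  have h1 := (hp 1).1
  fin_cases t <;> simp [P3beta] <;> linarith

lemma P3beta_pos {p : Fin 3 → ℝ} (hp : ∀ t, p t ∈ Set.Ioo (0 : ℝ) 1) {t : Fin 3}
    (ht : t ≠ 0) : 0 < P3beta p t := by
  have h0 := (hp 0).1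
  have h1 := (hp 1).1
  fin_cases t <;> simp [P3beta] at ht ⊢ <;> linarith

lemma P3beta_add_le_one {p : Fin 3 → ℝ} (hp : ∀ t, p t ∈ Set.Ioo (0 : ℝ) 1)
    (hsum : p 0 + p 1 + p 2 = 1) (t : Fin 3) : P3beta p t + p t ≤ 1 := by
  have h1 := (hp 1).1
  have h2 := (hp 2).1
  fin_cases t <;> simp [P3beta] <;> linarith

lemma P3beta_add_lt_one {p : Fin 3 → ℝ} (hp : ∀ t, p t ∈ Set.Ioo (0 : ℝ) 1)
    (hsum : p 0 + p 1 + p 2 = 1) {t : Fin 3} (ht : t ≠ 2) : P3beta p t + p t < 1 := by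
  have h1 := (hp 1).1
  have h2 := (hp 2).1
  fin_cases t <;> simp [P3beta] at ht ⊢ <;> linarith

/-- The half-open first-level intervals `[β_t, β_t + p_t)` are ordered by their digit. -/
lemma P3beta_add_le_of_lt {p : Fin 3 → ℝ} (hp : ∀ t, p t ∈ Set.Ioo (0 : ℝ) 1)
    {s t : Fin 3} (hst : s < t) : P3beta p s + p s ≤ P3beta p t := by
  have h1 := (hp 1).1
  fin_cases s <;> fin_cases t <;> simp [P3beta] at hst ⊢ <;> linarith

lemma P3term_nonneg {p : Fin 3 → ℝ} (hp : ∀ t, p t ∈ Set.Ioo (0 : ℝ) 1) (i : ℕ → Fin 3)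
    (k : ℕ) : 0 ≤ P3beta p (i k) * ∏ r ∈ Finset.range k, p (i r) :=
  mul_nonneg (P3beta_nonneg hp _) (Finset.prod_nonneg fun r _ => (hp (i r)).1.le)

lemma P3sum_add_prod_le_one {p : Fin 3 → ℝ} (hp : ∀ t, p t ∈ Set.Ioo (0 : ℝ) 1)
    (hsum : p 0 + p 1 + p 2 = 1) (i : ℕ → Fin 3) (n : ℕ) :
    ∑ k ∈ Finset.range n, P3beta p (i k) * ∏ r ∈ Finset.range k, p (i r)
      + ∏ r ∈ Finset.range n, p (i r) ≤ 1 := by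
  induction n with
  | zero => simp
  | succ n ih =>
    rw [Finset.sum_range_succ, Finset.prod_range_succ]
    have hP : 0 ≤ ∏ r ∈ Finset.range n, p (i r) :=
      Finset.prod_nonneg fun r _ => (hp (i r)).1.le
    nlinarith [P3beta_add_le_one hp hsum (i n)]

lemma P3sum_le_one {p : Fin 3 → ℝ} (hp : ∀ t, p t ∈ Set.Ioo (0 : ℝ) 1)
    (hsum : p 0 + p 1 + p 2 = 1) (i : ℕ → Fin 3) (n : ℕ) :
    ∑ k ∈ Finset.range n, P3beta p (i k) * ∏ r ∈ Finset.range k, p (i r) ≤ 1 := by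
  have hP : 0 ≤ ∏ r ∈ Finset.range n, p (i r) :=
    Finset.prod_nonneg fun r _ => (hp (i r)).1.le
  linarith [P3sum_add_prod_le_one hp hsum i n]

lemma P3summable {p : Fin 3 → ℝ} (hp : ∀ t, p t ∈ Set.Ioo (0 : ℝ) 1)
    (hsum : p 0 + p 1 + p 2 = 1) (i : ℕ → Fin 3) :
    Summable fun k : ℕ => P3beta p (i k) * ∏ r ∈ Finset.range k, p (i r) :=
  summable_of_sum_range_le (P3term_nonneg hp i) (P3sum_le_one hp hsum i)

lemma P3val_nonneg {p : Fin 3 → ℝ} (hp : ∀ t, p t ∈ Set.Ioo (0 : ℝ) 1) (i : ℕ → Fin 3) :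
    0 ≤ P3val p i :=
  tsum_nonneg (P3term_nonneg hp i)

lemma P3val_le_one {p : Fin 3 → ℝ} (hp : ∀ t, p t ∈ Set.Ioo (0 : ℝ) 1)
    (hsum : p 0 + p 1 + p 2 = 1) (i : ℕ → Fin 3) : P3val p i ≤ 1 :=
  Real.tsum_le_of_sum_range_le (P3term_nonneg hp i) (P3sum_le_one hp hsum i)

lemma P3val_eq_add_shift {p : Fin 3 → ℝ} (hp : ∀ t, p t ∈ Set.Ioo (0 : ℝ) 1)
    (hsum : p 0 + p 1 + p 2 = 1) (i : ℕ → Fin 3) :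
    P3val p i = P3beta p (i 0) + p (i 0) * P3val p (P3shift i) := by
  rw [P3val, (P3summable hp hsum i).tsum_eq_zero_add, P3val, ← tsum_mul_left]
  congr 1
  · simp
  · refine tsum_congr fun k => ?_
    rw [Finset.prod_range_succ']
    simp only [P3shift]
    ring

lemma P3val_pos {p : Fin 3 → ℝ} (hp : ∀ t, p t ∈ Set.Ioo (0 : ℝ) 1)
    (hsum : p 0 + p 1 + p 2 = 1) {i : ℕ → Fin 3} (hi : ∃ k, i k ≠ 0) : 0 < P3val p i := by
  obtain ⟨k, hk⟩ := hi
  exact (P3summable hp hsum i).tsum_pos (P3term_nonneg hp i) k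
    (mul_pos (P3beta_pos hp hk) (Finset.prod_pos fun r _ => (hp (i r)).1))

lemma P3val_lt_one {p : Fin 3 → ℝ} (hp : ∀ t, p t ∈ Set.Ioo (0 : ℝ) 1)
    (hsum : p 0 + p 1 + p 2 = 1) {i : ℕ → Fin 3} (hi : ∃ k, i k ≠ 2) : P3val p i < 1 := by
  obtain ⟨k, hk⟩ := hi
  induction k generalizing i with
  | zero =>
    rw [P3val_eq_add_shift hp hsum]
    nlinarith [P3beta_add_lt_one hp hsum hk, P3val_le_one hp hsum (P3shift i), (hp (i 0)).1]
  | succ k ih =>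
    rw [P3val_eq_add_shift hp hsum]
    have := ih (i := P3shift i) hk
    nlinarith [P3beta_add_le_one hp hsum (i 0), (hp (i 0)).1]

lemma P3val_const_two {p : Fin 3 → ℝ} (hp : ∀ t, p t ∈ Set.Ioo (0 : ℝ) 1)
    (hsum : p 0 + p 1 + p 2 = 1) : P3val p (fun _ => 2) = 1 := by
  have h := P3val_eq_add_shift hp hsum fun _ => 2
  have hs : P3shift (fun _ => 2) = fun _ => 2 := rfl
  have hb : P3beta p 2 = p 0 + p 1 := rfl
  rw [hs, hb] at h
  have h2 : (1 - p 2) ≠ 0 := by linarith [(hp 2).2]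
  apply mul_left_cancel₀ h2
  linarith

/-- Sequences with a common prefix of length `n` have values that are `q ^ n`-close. -/
lemma abs_P3val_sub_le_pow {p : Fin 3 → ℝ} (hp : ∀ t, p t ∈ Set.Ioo (0 : ℝ) 1)
    (hsum : p 0 + p 1 + p 2 = 1) {q : ℝ} (hq : ∀ t, p t ≤ q) (n : ℕ) {i j : ℕ → Fin 3}
    (hij : ∀ k < n, j k = i k) : |P3val p j - P3val p i| ≤ q ^ n := by
  induction n generalizing i j with
  | zero =>
    rw [abs_le, pow_zero]
    constructor <;> linarith [P3val_nonneg hp i, P3val_nonneg hp j, P3val_le_one hp hsum i,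
      P3val_le_one hp hsum j]
  | succ n ih =>
    have h := ih (i := P3shift i) (j := P3shift j) fun k hk => hij (k + 1) (by omega)
    rw [P3val_eq_add_shift hp hsum i, P3val_eq_add_shift hp hsum j, hij 0 (by omega),
      add_sub_add_left_eq_sub, ← mul_sub, abs_mul, abs_of_pos (hp (i 0)).1, pow_succ']
    exact mul_le_mul (hq _) h (abs_nonneg _) ((hp (i 0)).1.le.trans (hq _))

/-- A sequence that is neither eventually `0` nor eventually `2` lies in the interior of each of
its cylinders: sequences with nearby values share arbitrarily long prefixes with it. -/
lemma exists_forall_P3val_prefix_eq {p : Fin 3 → ℝ} (hp : ∀ t, p t ∈ Set.Ioo (0 : ℝ) 1)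
    (hsum : p 0 + p 1 + p 2 = 1) (n : ℕ) {i : ℕ → Fin 3} (h0 : ¬ ∃ N, ∀ k ≥ N, i k = 0)
    (h2 : ¬ ∃ N, ∀ k ≥ N, i k = 2) :
    ∃ δ > 0, ∀ j, |P3val p j - P3val p i| < δ → ∀ k < n, j k = i k := by
  induction n generalizing i with
  | zero => exact ⟨1, one_pos, by simp⟩
  | succ n ih =>
    have shift_not {t : Fin 3} (h : ¬ ∃ N, ∀ k ≥ N, i k = t) :
        ¬ ∃ N, ∀ k ≥ N, P3shift i k = t := by
      rintro ⟨N, hN⟩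
      refine h ⟨N + 1, fun k hk => ?_⟩
      obtain ⟨k, rfl⟩ := Nat.exists_eq_add_of_le' (show 1 ≤ k by omega)
      exact hN k (by omega)
    have exists_ne {t : Fin 3} (h : ¬ ∃ N, ∀ k ≥ N, i k = t) : ∃ k, P3shift i k ≠ t := by
      by_contra! hall
      exact shift_not h ⟨0, fun k _ => hall k⟩
    obtain ⟨δ, hδ, hclose⟩ := ih (shift_not h0) (shift_not h2)
    have hv0 := P3val_pos hp hsum (exists_ne h0)
    have hv1 := P3val_lt_one hp hsum (exists_ne h2)
    have hpi := (hp (i 0)).1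
    have hi := P3val_eq_add_shift hp hsum i
    set v := P3val p (P3shift i)
    refine ⟨p (i 0) * min δ (min v (1 - v)),
      mul_pos hpi (lt_min hδ (lt_min hv0 (sub_pos.2 hv1))), fun j hj => ?_⟩
    have hjδ : |P3val p j - P3val p i| < p (i 0) * δ :=
      hj.trans_le (mul_le_mul_of_nonneg_left (min_le_left _ _) hpi.le)
    have hjv : |P3val p j - P3val p i| < p (i 0) * v :=
      hj.trans_le (mul_le_mul_of_nonneg_left
        ((min_le_right _ _).trans (min_le_left _ _)) hpi.le)
    have hjv' : |P3val p j - P3val p i| < p (i 0) * (1 - v) :=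
      hj.trans_le (mul_le_mul_of_nonneg_left
        ((min_le_right _ _).trans (min_le_right _ _)) hpi.le)
    have hlow := (abs_lt.1 hjv).1
    have hhigh := (abs_lt.1 hjv').2
    have hpj := (hp (j 0)).1
    have hw0 := P3val_nonneg hp (P3shift j)
    have hw1 := P3val_le_one hp hsum (P3shift j)
    have hjval := P3val_eq_add_shift hp hsum j
    have hdigit : j 0 = i 0 := by
      rcases lt_trichotomy (j 0) (i 0) with h | h | h
      · nlinarith [P3beta_add_le_of_lt hp h]
      · exact h
      · nlinarith [P3beta_add_le_of_lt hp h]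
    intro k hk
    cases k with
    | zero => exact hdigit
    | succ k =>
      refine hclose (P3shift j) ?_ k (by omega)
      rw [hjval, hi, hdigit, add_sub_add_left_eq_sub, ← mul_sub, abs_mul, abs_of_pos hpi] at hjδ
      exact lt_of_mul_lt_mul_left hjδ hpi.le

theorem stmt7 (p : Fin 3 → ℝ) (hp : ∀ t, p t ∈ Set.Ioo (0 : ℝ) 1)
    (hsum : p 0 + p 1 + p 2 = 1)
    (f : ℝ → ℝ)
    (hf : ∀ i : ℕ → Fin 3, (¬ ∃ N, ∀ k ≥ N, i k = 2) →
      f (P3val p i) = P3val p (fun k => P3theta (i k)))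
    (hrep : ∀ x ∈ Set.Ico (0 : ℝ) 1, ∃ i : ℕ → Fin 3,
      (¬ ∃ N, ∀ k ≥ N, i k = 2) ∧ P3val p i = x)
    (x₀ : ℝ) (hx₀ : x₀ ∈ Set.Icc (0 : ℝ) 1)
    (hirr : ∀ i : ℕ → Fin 3, P3val p i = x₀ →
      (¬ ∃ N, ∀ k ≥ N, i k = 0) ∧ (¬ ∃ N, ∀ k ≥ N, i k = 2)) :
    ContinuousWithinAt f (Set.Icc 0 1) x₀ := by
  have hx1 : x₀ < 1 := by
    refine lt_of_le_of_ne hx₀.2 fun h => ?_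
    exact (hirr _ ((P3val_const_two hp hsum).trans h.symm)).2 ⟨0, fun _ _ => rfl⟩
  obtain ⟨i, hi2, rfl⟩ := hrep x₀ ⟨hx₀.1, hx1⟩
  obtain ⟨q, hq0, hq1, hq⟩ := exists_bound_P3 hp
  rw [Metric.continuousWithinAt_iff]
  intro ε hε
  obtain ⟨n, hn⟩ := exists_pow_lt_of_lt_one hε hq1
  obtain ⟨δ, hδ, hclose⟩ := exists_forall_P3val_prefix_eq hp hsum n (hirr i rfl).1 hi2
  refine ⟨min δ (1 - P3val p i), lt_min hδ (sub_pos.2 hx1), fun x hx hdist => ?_⟩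
  rw [Real.dist_eq, lt_min_iff] at hdist
  obtain ⟨j, hj2, rfl⟩ := hrep x ⟨hx.1, by linarith [(abs_lt.1 hdist.2).2]⟩
  rw [hf i hi2, hf j hj2, Real.dist_eq]
  refine (abs_P3val_sub_le_pow hp hsum hq n fun k hk => ?_).trans_lt hn
  rw [hclose j hdist.1 k hk]
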